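/- arXiv:math/0307195 — 2 statements merged into one kernel-verified Lean document; each statement's English description precedes it below -/
import Mathlib

section
/- Let (V,q) be a quadratic space over ℚ₂ of dimension d ≥ 3. If L and M are two even unimodular lattices in (V,q), then there is an isometry of (V,q) carrying L onto M. In particular, there is at most one isomorphism class of even unimodular lattices in (V,q). -/
/-- The symmetric bilinear form `B_q(x,y) = (q(x+y) - q(x) - q(y))/2` associated to a
quadratic form `q` on a `ℚ₂`-vector space `V`. -/
noncomputable def Bq {V : Type*} [AddCommGroup V] [Module ℚ_[2] V]
    (q : QuadraticForm ℚ_[2] V) (x y : V) : ℚ_[2] :=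
  (q (x + y) - q x - q y) / 2

/-- An element `c : ℚ₂` lies in `ℤ₂ ⊆ ℚ₂` iff its 2-adic norm is at most 1. -/
def IsIntegral2 (c : ℚ_[2]) : Prop := ‖c‖ ≤ 1

/-- A lattice in a `ℚ₂`-vector space `V`: a finitely generated `ℤ₂`-submodule
that spans `V` over `ℚ₂`. -/
def IsLattice {V : Type*} [AddCommGroup V] [Module ℚ_[2] V] [Module ℤ_[2] V]
    [IsScalarTower ℤ_[2] ℚ_[2] V] (L : Submodule ℤ_[2] V) : Prop :=
  L.FG ∧ Submodule.span ℚ_[2] (L : Set V) = ⊤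

/-- `x` lies in the dual lattice `L* = {x ∈ V : B_q(x, L) ⊆ ℤ₂}` of `L`. -/
def InDual {V : Type*} [AddCommGroup V] [Module ℚ_[2] V] [Module ℤ_[2] V]
    [IsScalarTower ℤ_[2] ℚ_[2] V] (q : QuadraticForm ℚ_[2] V) (L : Submodule ℤ_[2] V)
    (x : V) : Prop :=
  ∀ y ∈ L, IsIntegral2 (Bq q x y)

/-- `L` is unimodular: the dual lattice `L*` equals `L`. -/
def IsUnimodular {V : Type*} [AddCommGroup V] [Module ℚ_[2] V] [Module ℤ_[2] V]
    [IsScalarTower ℤ_[2] ℚ_[2] V] (q : QuadraticForm ℚ_[2] V) (L : Submodule ℤ_[2] V) : Prop :=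
  ∀ x : V, InDual q L x ↔ x ∈ L

/-- A lattice `L` is even when `q(L) ⊆ 2ℤ₂`; a unimodular lattice is odd when it is not even. -/
def IsEvenLat {V : Type*} [AddCommGroup V] [Module ℚ_[2] V] [Module ℤ_[2] V]
    [IsScalarTower ℤ_[2] ℚ_[2] V] (q : QuadraticForm ℚ_[2] V) (L : Submodule ℤ_[2] V) : Prop :=
  ∀ x ∈ L, IsIntegral2 (q x / 2)

section Form

variable {V : Type*} [AddCommGroup V] [Module ℚ_[2] V] (q : QuadraticForm ℚ_[2] V)

theorem Bq_eq_polar (x y : V) : Bq q x y = QuadraticMap.polar q x y / 2 := rfl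

theorem Bq_comm (x y : V) : Bq q x y = Bq q y x := by
  rw [Bq_eq_polar, Bq_eq_polar, QuadraticMap.polar_comm]

theorem Bq_add_left (x y z : V) : Bq q (x + y) z = Bq q x z + Bq q y z := by
  simp only [Bq_eq_polar, QuadraticMap.polar_add_left, add_div]

theorem Bq_smul_left (c : ℚ_[2]) (x z : V) : Bq q (c • x) z = c * Bq q x z := by
  simp only [Bq_eq_polar, QuadraticMap.polar_smul_left, smul_eq_mul, mul_div_assoc]

theorem Bq_add_right (x y z : V) : Bq q z (x + y) = Bq q z x + Bq q z y := by
  simp only [Bq_eq_polar, QuadraticMap.polar_add_right, add_div]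

theorem Bq_smul_right (c : ℚ_[2]) (x z : V) : Bq q z (c • x) = c * Bq q z x := by
  simp only [Bq_eq_polar, QuadraticMap.polar_smul_right, smul_eq_mul, mul_div_assoc]

theorem Bq_zero_left (z : V) : Bq q 0 z = 0 := by
  simp [Bq]

theorem Bq_neg_left (x z : V) : Bq q (-x) z = -Bq q x z := by
  rw [← neg_one_smul ℚ_[2] x, Bq_smul_left, neg_one_mul]

theorem Bq_neg_right (x z : V) : Bq q z (-x) = -Bq q z x := by
  rw [Bq_comm, Bq_neg_left, Bq_comm]

theorem Bq_sub_left (x y z : V) : Bq q (x - y) z = Bq q x z - Bq q y z := by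
  rw [sub_eq_add_neg, Bq_add_left, Bq_neg_left, sub_eq_add_neg]

theorem Bq_sub_right (x y z : V) : Bq q z (x - y) = Bq q z x - Bq q z y := by
  rw [sub_eq_add_neg, Bq_add_right, Bq_neg_right, sub_eq_add_neg]

theorem Bq_self (x : V) : Bq q x x = q x := by
  simp only [Bq_eq_polar, QuadraticMap.polar_self]
  ring

theorem Bq_map {W : Type*} [AddCommGroup W] [Module ℚ_[2] W] (q' : QuadraticForm ℚ_[2] W)
    (g : V →ₗ[ℚ_[2]] W) (hg : ∀ v, q' (g v) = q v) (x y : V) :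
    Bq q' (g x) (g y) = Bq q x y := by
  simp only [Bq, ← map_add, hg]

/-- The linear map rescaling a hyperbolic pair `x, y` to `c • x, c⁻¹ • y` and fixing its
orthogonal complement. -/
noncomputable def hyperbolicScaling (x y : V) (c : ℚ_[2]) : V →ₗ[ℚ_[2]] V where
  toFun v := v + ((c - 1) * Bq q v y) • x + ((c⁻¹ - 1) * Bq q v x) • y
  map_add' u v := by simp only [Bq_add_left]; module
  map_smul' a v := by simp only [Bq_smul_left, RingHom.id_apply]; module

theorem hyperbolicScaling_apply (x y : V) (c : ℚ_[2]) (v : V) :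
    hyperbolicScaling q x y c v
      = v + ((c - 1) * Bq q v y) • x + ((c⁻¹ - 1) * Bq q v x) • y := rfl

/-- The Eichler transvection attached to a singular vector `x` and a vector `w` orthogonal
to `x`. -/
noncomputable def eichler (x w : V) : V →ₗ[ℚ_[2]] V where
  toFun v := v + Bq q v x • w - (Bq q v w + q w / 2 * Bq q v x) • x
  map_add' u v := by simp only [Bq_add_left]; module
  map_smul' a v := by simp only [Bq_smul_left, RingHom.id_apply]; module

theorem eichler_apply (x w v : V) :
    eichler q x w v = v + Bq q v x • w - (Bq q v w + q w / 2 * Bq q v x) • x := rfl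

variable {q}

theorem hyperbolicScaling_comp_inv {x y : V} {c : ℚ_[2]} (hc : c ≠ 0) (hx : q x = 0)
    (hy : q y = 0) (hxy : Bq q x y = 1) :
    hyperbolicScaling q x y c ∘ₗ hyperbolicScaling q x y c⁻¹ = LinearMap.id := by
  have hyx : Bq q y x = 1 := by rw [Bq_comm, hxy]
  ext v
  simp only [LinearMap.comp_apply, hyperbolicScaling_apply, Bq_add_left, Bq_smul_left, Bq_self,
    hx, hy, hxy, hyx, LinearMap.id_apply]
  match_scalars <;> field_simp <;> ring

theorem quadratic_hyperbolicScaling {x y : V} {c : ℚ_[2]} (hc : c ≠ 0) (hx : q x = 0)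
    (hy : q y = 0) (hxy : Bq q x y = 1) (v : V) : q (hyperbolicScaling q x y c v) = q v := by
  have hyx : Bq q y x = 1 := by rw [Bq_comm, hxy]
  rw [← Bq_self, hyperbolicScaling_apply]
  simp only [Bq_add_left, Bq_smul_left, Bq_add_right, Bq_smul_right]
  simp only [Bq_self, hx, hy, hxy, hyx, Bq_comm q x v, Bq_comm q y v]
  field_simp
  ring

theorem eichler_comp_neg {x w : V} (hx : q x = 0) (hxw : Bq q x w = 0) :
    eichler q x w ∘ₗ eichler q x (-w) = LinearMap.id := by
  have hwx : Bq q w x = 0 := by rw [Bq_comm, hxw]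
  ext v
  simp only [LinearMap.comp_apply, eichler_apply, Bq_add_left, Bq_sub_left, Bq_smul_left, Bq_self,
    Bq_neg_left, Bq_neg_right, QuadraticMap.map_neg, hx, hxw, hwx, LinearMap.id_apply]
  match_scalars <;> ring

theorem quadratic_eichler {x w : V} (hx : q x = 0) (hxw : Bq q x w = 0) (v : V) :
    q (eichler q x w v) = q v := by
  have hwx : Bq q w x = 0 := by rw [Bq_comm, hxw]
  rw [← Bq_self, eichler_apply]
  simp only [Bq_add_left, Bq_smul_left, Bq_add_right, Bq_smul_right, Bq_sub_left, Bq_sub_right]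
  simp only [Bq_self, hx, hxw, hwx, Bq_comm q x v, Bq_comm q w v]
  ring

/-- Two hyperbolic pairs with proportional first vectors are related by an isometry. -/
theorem exists_isometry_hyperbolic_pair {x y y' : V} {c : ℚ_[2]} (hc : c ≠ 0) (hx : q x = 0)
    (hy : q y = 0) (hy' : q y' = 0) (hxy : Bq q x y = 1) (hxy' : Bq q (c • x) y' = 1) :
    ∃ g : V ≃ₗ[ℚ_[2]] V, (∀ v, q (g v) = q v) ∧ g x = c • x ∧ g y = y' := by
  have hyx : Bq q y x = 1 := by rw [Bq_comm, hxy]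
  rw [Bq_smul_left] at hxy'
  have hcx : q (c • x) = 0 := by rw [QuadraticMap.map_smul, hx, smul_zero]
  have hw : Bq q (c • x) (y' - c⁻¹ • y) = 0 := by
    simp only [Bq_sub_right, Bq_smul_left, Bq_smul_right, hxy, hxy']
    field_simp
    ring
  have hw' : Bq q (c • x) (-(y' - c⁻¹ • y)) = 0 := by rw [Bq_neg_right, hw, neg_zero]
  have hs := hyperbolicScaling_comp_inv (inv_ne_zero hc) hx hy hxy
  have he := eichler_comp_neg hcx hw'
  rw [inv_inv] at hs
  rw [neg_neg] at he
  let S : V ≃ₗ[ℚ_[2]] V :=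
    LinearEquiv.ofLinearMap _ _ (hyperbolicScaling_comp_inv hc hx hy hxy) hs
  let T : V ≃ₗ[ℚ_[2]] V := LinearEquiv.ofLinearMap _ _ (eichler_comp_neg hcx hw) he
  have hST (v : V) : (S.trans T) v
      = eichler q (c • x) (y' - c⁻¹ • y) (hyperbolicScaling q x y c v) := rfl
  refine ⟨S.trans T, fun v => ?_, ?_, ?_⟩
  · rw [hST, quadratic_eichler hcx hw, quadratic_hyperbolicScaling hc hx hy hxy]
  · have h : hyperbolicScaling q x y c x = c • x := by
      simp only [hyperbolicScaling_apply, Bq_self, hx, hxy]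
      module
    rw [hST, h, eichler_apply, hw, Bq_self, hcx]
    module
  · have h : hyperbolicScaling q x y c y = c⁻¹ • y := by
      simp only [hyperbolicScaling_apply, Bq_self, hy, hyx]
      module
    rw [hST, h, eichler_apply, ← Bq_self q (y' - c⁻¹ • y)]
    simp only [Bq_sub_left, Bq_sub_right, Bq_smul_left, Bq_smul_right]
    simp only [Bq_self, hy, hy', hyx, Bq_comm q y' y]
    match_scalars <;> field_simp <;> ring

variable (q) in
/-- The orthogonal complement of the pair `x, y`. -/
def pairPerp (x y : V) : Submodule ℚ_[2] V where
  carrier := {v | Bq q v x = 0 ∧ Bq q v y = 0}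
  add_mem' := by
    rintro a b ⟨ha, ha'⟩ ⟨hb, hb'⟩
    simp [Bq_add_left, ha, ha', hb, hb']
  zero_mem' := by simp [Bq_zero_left]
  smul_mem' := by
    rintro c a ⟨ha, ha'⟩
    simp [Bq_smul_left, ha, ha']

theorem mem_pairPerp {x y v : V} : v ∈ pairPerp q x y ↔ Bq q v x = 0 ∧ Bq q v y = 0 := Iff.rfl

/-- The orthogonal projection along the plane spanned by a hyperbolic pair. -/
noncomputable def pairProj {x y : V} (hx : q x = 0) (hy : q y = 0) (hxy : Bq q x y = 1) :
    V →ₗ[ℚ_[2]] pairPerp q x y where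
  toFun v := ⟨v - Bq q v y • x - Bq q v x • y, by
    have hyx : Bq q y x = 1 := by rw [Bq_comm, hxy]
    simp [mem_pairPerp, Bq_sub_left, Bq_smul_left, Bq_self, hx, hy, hxy, hyx]⟩
  map_add' u v := by
    ext
    simp only [Bq_add_left, Submodule.coe_add]
    module
  map_smul' a v := by
    ext
    simp only [Bq_smul_left, RingHom.id_apply, Submodule.coe_smul]
    module

theorem coe_pairProj {x y : V} (hx : q x = 0) (hy : q y = 0) (hxy : Bq q x y = 1) (v : V) :
    (pairProj hx hy hxy v : V) = v - Bq q v y • x - Bq q v x • y := rfl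

theorem Bq_comp_subtype (W : Submodule ℚ_[2] V) (v w : W) :
    Bq (q.comp W.subtype) v w = Bq q (v : V) w := rfl

theorem Bq_pairProj {x y : V} (hx : q x = 0) (hy : q y = 0)
    (hxy : Bq q x y = 1) (v : pairPerp q x y) (w : V) :
    Bq q (v : V) (pairProj hx hy hxy w : V) = Bq q (v : V) w := by
  rw [coe_pairProj]
  simp [Bq_sub_right, Bq_smul_right, v.2.1, v.2.2]

/-- An isometry of the orthogonal complement of a hyperbolic pair extends to an isometry fixing
the pair. -/
theorem exists_isometry_extending {x y : V} (hx : q x = 0) (hy : q y = 0) (hxy : Bq q x y = 1)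
    (h : pairPerp q x y ≃ₗ[ℚ_[2]] pairPerp q x y) (hh : ∀ v, q (h v) = q v) :
    ∃ g : V ≃ₗ[ℚ_[2]] V, (∀ v, q (g v) = q v) ∧
      ∀ v, g v = Bq q v y • x + Bq q v x • y + h (pairProj hx hy hxy v) := by
  have hyx : Bq q y x = 1 := by rw [Bq_comm, hxy]
  have hpx (w : pairPerp q x y) : Bq q (w : V) x = 0 := w.2.1
  have hpy (w : pairPerp q x y) : Bq q (w : V) y = 0 := w.2.2
  let E (k : pairPerp q x y →ₗ[ℚ_[2]] pairPerp q x y) : V →ₗ[ℚ_[2]] V :=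
    { toFun := fun v => Bq q v y • x + Bq q v x • y + k (pairProj hx hy hxy v)
      map_add' := fun u v => by
        simp only [Bq_add_left, map_add, Submodule.coe_add]
        module
      map_smul' := fun a v => by
        simp only [Bq_smul_left, map_smul, Submodule.coe_smul, RingHom.id_apply]
        module }
  have hE (k v) : E k v = Bq q v y • x + Bq q v x • y + k (pairProj hx hy hxy v) := rfl
  have hEx (k v) : Bq q (E k v) x = Bq q v x := by
    simp [hE, Bq_add_left, Bq_smul_left, Bq_self, hx, hyx, hpx]
  have hEy (k v) : Bq q (E k v) y = Bq q v y := by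
    simp [hE, Bq_add_left, Bq_smul_left, Bq_self, hy, hxy, hpy]
  have hEp (k v) : pairProj hx hy hxy (E k v) = k (pairProj hx hy hxy v) := by
    ext
    rw [coe_pairProj, hEx, hEy, hE]
    module
  have hcomp (k l : pairPerp q x y →ₗ[ℚ_[2]] pairPerp q x y) (hkl : k ∘ₗ l = LinearMap.id) :
      E k ∘ₗ E l = LinearMap.id := by
    ext v
    have := LinearMap.congr_fun hkl (pairProj hx hy hxy v)
    simp only [LinearMap.comp_apply, LinearMap.id_apply] at this ⊢
    rw [hE k, hEx, hEy, hEp, this, coe_pairProj]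
    module
  have hq (w : pairPerp q x y) (a b : ℚ_[2]) : q (a • x + b • y + w) = 2 * a * b + q w := by
    rw [← Bq_self]
    simp only [Bq_add_left, Bq_smul_left, Bq_add_right, Bq_smul_right]
    simp only [Bq_self, hx, hy, hxy, hyx, hpx, hpy, Bq_comm q x (w : V), Bq_comm q y (w : V)]
    ring
  refine ⟨LinearEquiv.ofLinearMap (E h) (E h.symm) (hcomp _ _ ?_) (hcomp _ _ ?_), fun v => ?_,
    fun v => rfl⟩
  · ext; simp
  · ext; simp
  · change q (E h v) = q v
    rw [hE, hq, LinearEquiv.coe_coe, hh, ← hq, coe_pairProj]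
    congr 1
    module

end Form

section Lattice

theorem norm_half_mul_le_one_of_norm_lt_one {a : ℚ_[2]} (ha : ‖a‖ < 1) :
    ‖(2 : ℚ_[2])⁻¹ * a‖ ≤ 1 := by
  obtain ⟨b, hb⟩ := (PadicInt.norm_lt_one_iff_dvd (p := 2) ⟨a, ha.le⟩).1 ha
  have h : a = 2 * (b : ℚ_[2]) := by
    have := congrArg ((↑) : ℤ_[2] → ℚ_[2]) hb
    rwa [PadicInt.coe_mul] at this
  rw [h, inv_mul_cancel_left₀ two_ne_zero]
  exact b.2

theorem norm_two_lt_one : ‖(2 : ℚ_[2])‖ < 1 := by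
  have := Padic.norm_p_lt_one (p := 2)
  simpa using this

/-- Hensel's lemma for `b t² + t + a` with `a` even. -/
theorem exists_small_root {a b : ℚ_[2]} (ha : ‖a‖ < 1) (hb : ‖b‖ ≤ 1) :
    ∃ t : ℚ_[2], ‖t‖ < 1 ∧ a + t + b * t ^ 2 = 0 := by
  let a' : ℤ_[2] := ⟨a, ha.le⟩
  let b' : ℤ_[2] := ⟨b, hb⟩
  let F : Polynomial ℤ_[2] :=
    Polynomial.C b' * Polynomial.X ^ 2 + Polynomial.X + Polynomial.C a'
  have h0 : ‖F.aeval (0 : ℤ_[2])‖ < ‖F.derivative.aeval (0 : ℤ_[2])‖ ^ 2 := by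
    simpa [F] using (show ‖a'‖ < 1 from ha)
  obtain ⟨t, ht, ht', -⟩ := hensels_lemma h0
  refine ⟨t, ?_, ?_⟩
  · simpa [F] using ht'
  · have h : (b' * t ^ 2 + t + a' : ℤ_[2]) = 0 := by simpa [F] using ht
    have := congrArg ((↑) : ℤ_[2] → ℚ_[2]) h
    push_cast at this
    change b * (t : ℚ_[2]) ^ 2 + t + a = 0 at this
    linear_combination this

variable {V : Type*} [AddCommGroup V] [Module ℚ_[2] V] [Module ℤ_[2] V]
  [IsScalarTower ℤ_[2] ℚ_[2] V] {q : QuadraticForm ℚ_[2] V} {L M : Submodule ℤ_[2] V}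

theorem smul_mem_of_norm_le_one {c : ℚ_[2]} (hc : ‖c‖ ≤ 1) {v : V} (hv : v ∈ L) : c • v ∈ L := by
  let c' : ℤ_[2] := ⟨c, hc⟩
  have : c' • v = c • v := (algebraMap_smul ℚ_[2] c' v).symm
  exact this ▸ L.smul_mem c' hv

theorem exists_pow_smul_mem (hL : Submodule.span ℚ_[2] (L : Set V) = ⊤) (v : V) :
    ∃ n : ℕ, (2 : ℚ_[2]) ^ n • v ∈ L := by
  have hup {n m : ℕ} {w : V} (hw : (2 : ℚ_[2]) ^ n • w ∈ L) : (2 : ℚ_[2]) ^ (m + n) • w ∈ L := by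
    rw [pow_add, mul_smul]
    refine smul_mem_of_norm_le_one ?_ hw
    rw [norm_pow]
    exact pow_le_one₀ (norm_nonneg _) norm_two_lt_one.le
  have hv : v ∈ Submodule.span ℚ_[2] (L : Set V) := hL ▸ Submodule.mem_top
  induction hv using Submodule.span_induction with
  | mem x hx => exact ⟨0, by simpa using hx⟩
  | zero => exact ⟨0, by simp⟩
  | add x y _ _ hx hy =>
    obtain ⟨n, hn⟩ := hx
    obtain ⟨m, hm⟩ := hy
    refine ⟨m + n, ?_⟩
    rw [smul_add]
    refine L.add_mem (hup hn) ?_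
    rw [add_comm]
    exact hup hm
  | smul c x _ hx =>
    obtain ⟨n, hn⟩ := hx
    obtain ⟨m, hm⟩ : ∃ m : ℕ, ‖(2 : ℚ_[2]) ^ m * c‖ ≤ 1 := by
      have h := (tendsto_pow_atTop_nhds_zero_of_norm_lt_one norm_two_lt_one).mul_const c
      rw [zero_mul] at h
      have h' := (tendsto_norm_zero.comp h).eventually (gt_mem_nhds one_pos)
      obtain ⟨m, hm⟩ := h'.exists
      exact ⟨m, hm.le⟩
    refine ⟨m + n, ?_⟩
    have : (2 : ℚ_[2]) ^ (m + n) • c • x = ((2 : ℚ_[2]) ^ m * c) • (2 : ℚ_[2]) ^ n • x := by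
      rw [smul_smul, smul_smul]
      ring_nf
    rw [this]
    exact smul_mem_of_norm_le_one hm hn

theorem norm_Bq_le_one (hLu : IsUnimodular q L) {x y : V} (hx : x ∈ L) (hy : y ∈ L) :
    ‖Bq q x y‖ ≤ 1 :=
  (hLu x).2 hx y hy

/-- A primitive vector of a unimodular lattice pairs to `1` with some lattice vector. -/
theorem exists_Bq_eq_one (hLu : IsUnimodular q L) {z : V} (hz : z ∈ L)
    (hz' : (2 : ℚ_[2])⁻¹ • z ∉ L) : ∃ y ∈ L, Bq q z y = 1 := by
  rw [← hLu] at hz'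
  simp only [InDual, IsIntegral2, Bq_smul_left, not_forall] at hz'
  obtain ⟨y, hy, h⟩ := hz'
  have h1 : ‖Bq q z y‖ = 1 :=
    (norm_Bq_le_one hLu hz hy).eq_of_not_lt fun hlt => h (norm_half_mul_le_one_of_norm_lt_one hlt)
  have h0 : Bq q z y ≠ 0 := fun h0 => by simp [h0] at h1
  exact ⟨(Bq q z y)⁻¹ • y, smul_mem_of_norm_le_one (by rw [norm_inv, h1, inv_one]) hy,
    by rw [Bq_smul_right, inv_mul_cancel₀ h0]⟩

/-- A nonzero vector has a primitive multiple in a unimodular lattice. -/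
theorem exists_primitive_smul (hnd : ∀ x : V, (∀ y : V, Bq q x y = 0) → x = 0)
    (hLs : ∀ v : V, ∃ n : ℕ, (2 : ℚ_[2]) ^ n • v ∈ L) (hLu : IsUnimodular q L) {x : V}
    (hx : x ≠ 0) : ∃ c : ℚ_[2], c ≠ 0 ∧ c • x ∈ L ∧ (2 : ℚ_[2])⁻¹ • c • x ∉ L := by
  obtain ⟨N, hN⟩ := hLs x
  by_contra! hcon
  have hall (k : ℕ) : ((2 : ℚ_[2])⁻¹ ^ k * 2 ^ N) • x ∈ L := by
    induction k with
    | zero => simpa using hN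
    | succ k ih =>
      have := hcon _ (mul_ne_zero (by simp) (by simp)) ih
      rwa [smul_smul, ← mul_assoc, ← pow_succ'] at this
  refine hx (hnd x fun y => ?_)
  obtain ⟨m, hm⟩ := hLs y
  by_contra hxy
  have hbound (k : ℕ) : ‖(2 : ℚ_[2]) ^ N * (2 ^ m * Bq q x y)‖ ≤ ‖(2 : ℚ_[2])‖ ^ k := by
    have := norm_Bq_le_one hLu (hall k) hm
    rw [Bq_smul_left, Bq_smul_right, mul_assoc, norm_mul, norm_pow, norm_inv, inv_pow,
      inv_mul_le_iff₀ (pow_pos (norm_pos_iff.2 two_ne_zero) _), mul_one] at this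
    exact this
  have h0 := ge_of_tendsto' (tendsto_pow_atTop_nhds_zero_of_lt_one (norm_nonneg _) norm_two_lt_one)
    hbound
  have : (2 : ℚ_[2]) ^ N * (2 ^ m * Bq q x y) = 0 := norm_le_zero_iff.1 h0
  simp [hxy] at this

/-- A singular vector has a multiple that is half of a hyperbolic pair in the lattice. -/
theorem exists_hyperbolic_pair (hnd : ∀ x : V, (∀ y : V, Bq q x y = 0) → x = 0)
    (hLs : ∀ v : V, ∃ n : ℕ, (2 : ℚ_[2]) ^ n • v ∈ L) (hLu : IsUnimodular q L)
    (hLe : IsEvenLat q L) {x : V} (hx : x ≠ 0) (hqx : q x = 0) :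
    ∃ c : ℚ_[2], c ≠ 0 ∧ c • x ∈ L ∧ ∃ y ∈ L, q y = 0 ∧ Bq q (c • x) y = 1 := by
  obtain ⟨c, hc, hcx, hcx'⟩ := exists_primitive_smul hnd hLs hLu hx
  obtain ⟨y, hy, hxy⟩ := exists_Bq_eq_one hLu hcx hcx'
  have hq : q (c • x) = 0 := by rw [QuadraticMap.map_smul, hqx, smul_zero]
  have hyx : Bq q y (c • x) = 1 := by rw [Bq_comm, hxy]
  refine ⟨c, hc, hcx, y - (q y / 2) • c • x,
    L.sub_mem hy (smul_mem_of_norm_le_one (hLe y hy) hcx), ?_, ?_⟩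
  · rw [← Bq_self]
    simp only [Bq_sub_left, Bq_sub_right, Bq_smul_left q (q y / 2), Bq_smul_right q (q y / 2)]
    simp only [Bq_self, hq, hxy, hyx]
    ring
  · rw [Bq_sub_right, Bq_smul_right, Bq_self, hq, hxy]
    ring

/-- In an anisotropic space the only even unimodular lattice is `{x | q x / 2 ∈ ℤ₂}`. -/
theorem mem_iff_of_anisotropic (hq : ∀ x, q x = 0 → x = 0)
    (hLs : ∀ v : V, ∃ n : ℕ, (2 : ℚ_[2]) ^ n • v ∈ L) (hLu : IsUnimodular q L)
    (hLe : IsEvenLat q L) (x : V) : x ∈ L ↔ IsIntegral2 (q x / 2) := by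
  classical
  refine ⟨hLe x, fun hqx => ?_⟩
  by_contra hxL
  have hspec := Nat.find_spec (hLs x)
  rcases hn : Nat.find (hLs x) with _ | n
  · rw [hn] at hspec
    exact hxL (by simpa using hspec)
  rw [hn] at hspec
  obtain ⟨y, hy, hxy⟩ := exists_Bq_eq_one hLu hspec (by
    rw [smul_smul, pow_succ', inv_mul_cancel_left₀ two_ne_zero]
    exact Nat.find_min (hLs x) (by omega))
  set z := (2 : ℚ_[2]) ^ (n + 1) • x with hz
  have ha : ‖q z / 2‖ < 1 := by
    have : q z / 2 = 2 * (2 ^ n * 2 ^ (n + 1) * (q x / 2)) := by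
      rw [hz, QuadraticMap.map_smul, smul_eq_mul]
      ring
    rw [this, norm_mul]
    refine mul_lt_one_of_nonneg_of_lt_one_left (norm_nonneg _) norm_two_lt_one ?_
    rw [norm_mul, norm_mul, norm_pow, norm_pow]
    exact mul_le_one₀ (mul_le_one₀ (pow_le_one₀ (norm_nonneg _) norm_two_lt_one.le) (by positivity)
      (pow_le_one₀ (norm_nonneg _) norm_two_lt_one.le)) (norm_nonneg _) hqx
  obtain ⟨t, ht, htq⟩ := exists_small_root ha (hLe y hy)
  have hzero : z + t • y = 0 := by
    apply hq
    rw [← Bq_self]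
    simp only [Bq_add_left, Bq_add_right, Bq_smul_left q t, Bq_smul_right q t]
    simp only [Bq_self, Bq_comm q y z, hxy]
    linear_combination 2 * htq
  have h1 : 1 + t * q y = 0 := by
    rw [← hxy, ← Bq_self q y, ← Bq_smul_left, ← Bq_add_left, hzero, Bq_zero_left]
  have h2 : ‖t * q y‖ < 1 := by
    rw [norm_mul]
    exact mul_lt_one_of_nonneg_of_lt_one_left (norm_nonneg _) ht
      (Bq_self q y ▸ norm_Bq_le_one hLu hy hy)
  rw [← neg_eq_of_add_eq_zero_right h1, norm_neg, norm_one] at h2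
  exact lt_irrefl _ h2

variable (L) in
/-- The part of a lattice orthogonal to the pair `x, y`. -/
noncomputable def latticePerp (q : QuadraticForm ℚ_[2] V) (x y : V) :
    Submodule ℤ_[2] (pairPerp q x y) :=
  L.comap ((pairPerp q x y).subtype.restrictScalars ℤ_[2])

theorem mem_latticePerp {x y : V} {v : pairPerp q x y} :
    v ∈ latticePerp L q x y ↔ (v : V) ∈ L := Iff.rfl

theorem pairProj_mem_iff (hLu : IsUnimodular q L) {x y : V} (hx : q x = 0) (hy : q y = 0)
    (hxy : Bq q x y = 1) (hxL : x ∈ L) (hyL : y ∈ L) (v : V) :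
    v ∈ L ↔ ‖Bq q v x‖ ≤ 1 ∧ ‖Bq q v y‖ ≤ 1 ∧ pairProj hx hy hxy v ∈ latticePerp L q x y := by
  rw [mem_latticePerp, coe_pairProj]
  constructor
  · intro hv
    have h1 := norm_Bq_le_one hLu hv hxL
    have h2 := norm_Bq_le_one hLu hv hyL
    exact ⟨h1, h2, L.sub_mem (L.sub_mem hv (smul_mem_of_norm_le_one h2 hxL))
      (smul_mem_of_norm_le_one h1 hyL)⟩
  · rintro ⟨h1, h2, h⟩
    have := L.add_mem h (L.add_mem (smul_mem_of_norm_le_one h2 hxL)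
      (smul_mem_of_norm_le_one h1 hyL))
    convert this using 1
    module

theorem isUnimodular_latticePerp (hLu : IsUnimodular q L) {x y : V} (hx : q x = 0) (hy : q y = 0)
    (hxy : Bq q x y = 1) (hxL : x ∈ L) (hyL : y ∈ L) :
    IsUnimodular (q.comp (pairPerp q x y).subtype) (latticePerp L q x y) := by
  intro v
  rw [mem_latticePerp, ← hLu]
  refine ⟨fun h w hw => ?_, fun h w hw => h w hw⟩
  have := h _ ((pairProj_mem_iff hLu hx hy hxy hxL hyL w).1 hw).2.2
  rwa [Bq_comp_subtype, Bq_pairProj] at this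

theorem isUnimodular_comap (hMu : IsUnimodular q M) (g : V ≃ₗ[ℚ_[2]] V) (hg : ∀ v, q (g v) = q v) :
    IsUnimodular q (M.comap (g.toLinearMap.restrictScalars ℤ_[2])) := by
  intro v
  have hB (y : V) : Bq q (g v) (g y) = Bq q v y := Bq_map q q g.toLinearMap hg v y
  refine Iff.trans ⟨fun h w hw => ?_, fun h w hw => ?_⟩ (hMu (g v))
  · have := h (g.symm w) (by simpa using hw)
    rwa [← hB, g.apply_symm_apply] at this
  · rw [← hB]
    exact h (g w) hw

end Lattice

/-- Two even unimodular lattices in a nondegenerate quadratic space are related by an isometry: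
an anisotropic space has only one such lattice, and otherwise both lattices split off a hyperbolic
plane. -/
theorem exists_isometry_mem_iff (n : ℕ) :
    ∀ {V : Type*} [AddCommGroup V] [Module ℚ_[2] V] [Module ℤ_[2] V]
      [IsScalarTower ℤ_[2] ℚ_[2] V] [FiniteDimensional ℚ_[2] V],
      Module.finrank ℚ_[2] V = n → ∀ q : QuadraticForm ℚ_[2] V,
      (∀ x : V, (∀ y : V, Bq q x y = 0) → x = 0) → ∀ L M : Submodule ℤ_[2] V,
      (∀ v : V, ∃ n : ℕ, (2 : ℚ_[2]) ^ n • v ∈ L) →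
      (∀ v : V, ∃ n : ℕ, (2 : ℚ_[2]) ^ n • v ∈ M) →
      IsUnimodular q L → IsUnimodular q M → IsEvenLat q L → IsEvenLat q M →
      ∃ g : V ≃ₗ[ℚ_[2]] V, (∀ x : V, q (g x) = q x) ∧ ∀ x : V, g x ∈ M ↔ x ∈ L := by
  induction n using Nat.strong_induction_on with
  | _ n ih =>
  intro V _ _ _ _ _ hn q hnd L M hLs hMs hLu hMu hLe hMe
  by_cases hani : ∀ x, q x = 0 → x = 0
  · exact ⟨LinearEquiv.refl _ _, fun _ => rfl, fun x =>
      (mem_iff_of_anisotropic hani hMs hMu hMe x).trans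
        (mem_iff_of_anisotropic hani hLs hLu hLe x).symm⟩
  push Not at hani
  obtain ⟨e, hqe, he⟩ := hani
  obtain ⟨a, ha, hxL, y, hyL, hqy, hxy⟩ := exists_hyperbolic_pair hnd hLs hLu hLe he hqe
  obtain ⟨b, hb, hxM, y', hyM, hqy', hxy'⟩ := exists_hyperbolic_pair hnd hMs hMu hMe he hqe
  obtain ⟨x, rfl⟩ : ∃ x, x = a • e := ⟨_, rfl⟩
  have hbe : b • e = (b * a⁻¹) • a • e := by rw [smul_smul, inv_mul_cancel_right₀ ha]
  have hqx : q (a • e) = 0 := by rw [QuadraticMap.map_smul, hqe, smul_zero]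
  rw [hbe] at hxM hxy'
  generalize a • e = x at *
  obtain ⟨g, hg, hgx, hgy⟩ := exists_isometry_hyperbolic_pair (mul_ne_zero hb (inv_ne_zero ha))
    hqx hqy hqy' hxy hxy'
  set N : Submodule ℤ_[2] V := M.comap (g.toLinearMap.restrictScalars ℤ_[2])
  have hmemN (v : V) : v ∈ N ↔ g v ∈ M := Iff.rfl
  have hNu : IsUnimodular q N := isUnimodular_comap hMu g hg
  have hxN : x ∈ N := by rwa [hmemN, hgx]
  have hyN : y ∈ N := by rwa [hmemN, hgy]
  have hlt : Module.finrank ℚ_[2] (pairPerp q x y) < n := by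
    rw [← hn]
    refine Submodule.finrank_lt fun htop => ?_
    have : x ∈ pairPerp q x y := htop ▸ Submodule.mem_top
    exact one_ne_zero (hxy.symm.trans this.2)
  obtain ⟨h, hh, hhm⟩ := ih _ hlt rfl (q.comp (pairPerp q x y).subtype)
    (fun v hv => Subtype.ext (hnd v fun w => by
      rw [← Bq_pairProj hqx hqy hxy]; exact hv _))
    (latticePerp L q x y) (latticePerp N q x y)
    (fun v => hLs v)
    (fun v => (hMs (g v)).imp fun n h => by
      rw [mem_latticePerp, hmemN]
      simpa using h)
    (isUnimodular_latticePerp hLu hqx hqy hxy hxL hyL)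
    (isUnimodular_latticePerp hNu hqx hqy hxy hxN hyN)
    (fun v hv => hLe v hv)
    (fun v hv => by
      have := hMe _ hv
      change IsIntegral2 (q (g v) / 2) at this
      rwa [hg] at this)
  obtain ⟨k, hk, hkv⟩ := exists_isometry_extending hqx hqy hxy h hh
  refine ⟨k.trans g, fun v => by rw [LinearEquiv.trans_apply, hg, hk], fun v => ?_⟩
  have hyx : Bq q y x = 1 := by rw [Bq_comm, hxy]
  have hkx : Bq q (k v) x = Bq q v x := by
    rw [hkv]
    simp [Bq_add_left, Bq_smul_left, Bq_self, hqx, hyx, (h (pairProj hqx hqy hxy v)).2.1]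
  have hky : Bq q (k v) y = Bq q v y := by
    rw [hkv]
    simp [Bq_add_left, Bq_smul_left, Bq_self, hqy, hxy, (h (pairProj hqx hqy hxy v)).2.2]
  have hkp : pairProj hqx hqy hxy (k v) = h (pairProj hqx hqy hxy v) := by
    ext
    rw [coe_pairProj, hkx, hky, hkv]
    module
  rw [LinearEquiv.trans_apply, ← hmemN, pairProj_mem_iff hNu hqx hqy hxy hxN hyN,
    pairProj_mem_iff hLu hqx hqy hxy hxL hyL, hkx, hky, hkp, hhm]

/-- There is at most one isomorphism class of even unimodular lattices in a quadratic space
`(V, q)` over `ℚ₂` of dimension `d ≥ 3`: any two even unimodular lattices are carried onto each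
other by an isometry of `(V, q)`. -/
theorem even_unimodular_lattices_isometric
    {V : Type*} [AddCommGroup V] [Module ℚ_[2] V] [Module ℤ_[2] V]
    [IsScalarTower ℤ_[2] ℚ_[2] V] [FiniteDimensional ℚ_[2] V]
    (d : ℕ) (hd : 3 ≤ d) (hdim : Module.finrank ℚ_[2] V = d)
    (q : QuadraticForm ℚ_[2] V)
    (hnd : ∀ x : V, (∀ y : V, Bq q x y = 0) → x = 0)
    (L M : Submodule ℤ_[2] V) (hL : IsLattice L) (hM : IsLattice M)
    (hLu : IsUnimodular q L) (hMu : IsUnimodular q M)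
    (hLe : IsEvenLat q L) (hMe : IsEvenLat q M) :
    ∃ g : V ≃ₗ[ℚ_[2]] V, (∀ x : V, q (g x) = q x) ∧ ⇑g '' (L : Set V) = (M : Set V) := by
  obtain ⟨g, hg, hgm⟩ := exists_isometry_mem_iff d hdim q hnd L M (exists_pow_smul_mem hL.2)
    (exists_pow_smul_mem hM.2) hLu hMu hLe hMe
  refine ⟨g, hg, Set.ext fun v => ⟨?_, fun hv => ⟨g.symm v, ?_, g.apply_symm_apply v⟩⟩⟩
  · rintro ⟨x, hx, rfl⟩
    exact (hgm x).2 hx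
  · exact (hgm _).1 (by rwa [g.apply_symm_apply])
end

section
/- Let (V,q) be a quadratic space over ℚ₂ of odd dimension d ≥ 3, let L be an odd unimodular lattice in (V,q), and let Λ = {x ∈ L : q(x) ∈ 2ℤ₂}. Then the stabilizers of L and of Λ in SO(V,q)(ℚ₂) coincide: an isometry g of (V,q) with determinant 1 satisfies g(L) = L if and only if it satisfies g(Λ) = Λ. -/
/-- A symmetric matrix of odd size over `ℤ/2` with zero diagonal is singular. -/
theorem Matrix.det_eq_zero_of_symm_of_diag_zmod_two {n : ℕ} (hn : Odd n)
    (M : Matrix (Fin n) (Fin n) (ZMod 2)) (hsymm : ∀ i j, M i j = M j i)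
    (hdiag : ∀ i, M i i = 0) : M.det = 0 := by
  let S : Matrix (Fin n) (Fin n) ℤ := Matrix.of fun i j =>
    if i < j then ((M i j).val : ℤ) else if j < i then -((M i j).val : ℤ) else 0
  have hS : S.map (Int.castRingHom (ZMod 2)) = M := by
    ext i j
    rcases lt_trichotomy i j with h | rfl | h
    · simp [S, h]
    · simp [S, hdiag]
    · simp [S, h, h.not_gt, ZMod.neg_eq_self_mod_two]
  have hskew : S.transpose = -S := by
    ext i j
    rcases lt_trichotomy i j with h | rfl | h
    · simp [S, h, h.not_gt, hsymm j i]
    · simp [S]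
    · simp [S, h, h.not_gt, hsymm j i]
  have hdet : S.det = 0 := by
    have h := S.det_transpose
    rw [hskew, Matrix.det_neg, Fintype.card_fin, hn.neg_one_pow] at h
    linarith
  rw [← hS, ← RingHom.mapMatrix_apply, ← RingHom.map_det, hdet, map_zero]

theorem PadicInt.two_dvd_iff_toZMod_eq_zero (x : ℤ_[2]) :
    2 ∣ x ↔ PadicInt.toZMod x = 0 := by
  rw [← RingHom.mem_ker, PadicInt.ker_toZMod, PadicInt.maximalIdeal_eq_span_p,
    Ideal.mem_span_singleton]
  norm_num

theorem PadicInt.coe_two : ((2 : ℤ_[2]) : ℚ_[2]) = 2 := PadicInt.coe_natCast 2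

namespace IsIntegral2

variable {a b : ℚ_[2]}

theorem coe (a : ℤ_[2]) : IsIntegral2 (a : ℚ_[2]) := a.2

theorem exists_eq (ha : IsIntegral2 a) : ∃ z : ℤ_[2], (z : ℚ_[2]) = a := ⟨⟨a, ha⟩, rfl⟩

theorem one : IsIntegral2 1 := by simpa using coe 1

theorem two : IsIntegral2 2 := PadicInt.coe_two ▸ coe 2

theorem add (ha : IsIntegral2 a) (hb : IsIntegral2 b) : IsIntegral2 (a + b) := by
  obtain ⟨x, rfl⟩ := ha.exists_eq
  obtain ⟨y, rfl⟩ := hb.exists_eq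
  exact mod_cast coe (x + y)

theorem mul (ha : IsIntegral2 a) (hb : IsIntegral2 b) : IsIntegral2 (a * b) := by
  obtain ⟨x, rfl⟩ := ha.exists_eq
  obtain ⟨y, rfl⟩ := hb.exists_eq
  exact mod_cast coe (x * y)

theorem sub (ha : IsIntegral2 a) (hb : IsIntegral2 b) : IsIntegral2 (a - b) := by
  obtain ⟨x, rfl⟩ := ha.exists_eq
  obtain ⟨y, rfl⟩ := hb.exists_eq
  exact mod_cast coe (x - y)

theorem half_coe_iff (a : ℤ_[2]) : IsIntegral2 ((a : ℚ_[2]) / 2) ↔ 2 ∣ a := by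
  constructor
  · intro h
    obtain ⟨z, hz⟩ := h.exists_eq
    refine ⟨z, ?_⟩
    have h2 : (a : ℚ_[2]) = 2 * z := by rw [hz]; ring
    rw [← PadicInt.coe_two, ← PadicInt.coe_mul] at h2
    exact Subtype.ext h2
  · rintro ⟨z, rfl⟩
    rw [PadicInt.coe_mul, PadicInt.coe_two, mul_div_cancel_left₀ _ two_ne_zero]
    exact coe z

theorem half_or_half_sub_one (ha : IsIntegral2 a) :
    IsIntegral2 (a / 2) ∨ IsIntegral2 ((a - 1) / 2) := by
  obtain ⟨z, rfl⟩ := ha.exists_eq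
  have h := half_coe_iff (z - 1)
  push_cast at h
  rw [h, half_coe_iff, PadicInt.two_dvd_iff_toZMod_eq_zero,
    PadicInt.two_dvd_iff_toZMod_eq_zero, map_sub, map_one]
  generalize PadicInt.toZMod z = t
  revert t
  decide

theorem half_sub_of_not (ha : IsIntegral2 a) (hb : IsIntegral2 b)
    (ha2 : ¬ IsIntegral2 (a / 2)) (hb2 : ¬ IsIntegral2 (b / 2)) :
    IsIntegral2 ((a - b) / 2) := by
  have h := (ha.half_or_half_sub_one.resolve_left ha2).sub
    (hb.half_or_half_sub_one.resolve_left hb2)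
  convert h using 1
  ring

end IsIntegral2

theorem Bq_eq_associated {V : Type*} [AddCommGroup V] [Module ℚ_[2] V]
    (q : QuadraticForm ℚ_[2] V) (x y : V) :
    Bq q x y = QuadraticMap.associated q x y := by
  rw [QuadraticMap.associated_apply, Bq, Module.End.smul_def,
    QuadraticMap.half_moduleEnd_apply_eq_half_smul, smul_eq_mul, invOf_eq_inv]
  ring

section Lattice

variable {V : Type*} [AddCommGroup V] [Module ℚ_[2] V] [Module ℤ_[2] V]
  [IsScalarTower ℤ_[2] ℚ_[2] V]

/-- On a lattice of odd rank, an integral symmetric form with even values on the diagonal is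
degenerate modulo 2. -/
theorem exists_mem_radical_mod_two [FiniteDimensional ℚ_[2] V]
    (hodd : Odd (Module.finrank ℚ_[2] V)) (γ : LinearMap.BilinForm ℚ_[2] V)
    {L : Submodule ℤ_[2] V} (hL : IsLattice L) (hsymm : ∀ x y, γ x y = γ y x)
    (hint : ∀ x ∈ L, ∀ y ∈ L, IsIntegral2 (γ x y))
    (halt : ∀ x ∈ L, IsIntegral2 (γ x x / 2)) :
    ∃ w ∈ L, (2⁻¹ : ℚ_[2]) • w ∉ L ∧ ∀ y ∈ L, IsIntegral2 (γ w y / 2) := by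
  have : Submodule.IsLattice ℚ_[2] L := ⟨hL.1, hL.2⟩
  have : Module.Free ℤ_[2] L := Submodule.IsLattice.free ℚ_[2] L
  have hrank : Module.finrank ℤ_[2] L = Module.finrank ℚ_[2] V :=
    congrArg Cardinal.toNat (Submodule.IsLattice.rank' ℚ_[2] L)
  let b := Module.finBasisOfFinrankEq ℤ_[2] L hrank
  have hsmul : ∀ (c : ℤ_[2]) (x : V), c • x = (c : ℚ_[2]) • x := fun c x =>
    (algebraMap_smul ℚ_[2] c x).symm
  let G : Matrix (Fin (Module.finrank ℚ_[2] V)) (Fin (Module.finrank ℚ_[2] V)) ℤ_[2] :=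
    Matrix.of fun i j => ⟨γ (b i) (b j), hint _ (b i).2 _ (b j).2⟩
  have hG : ∀ i j, ((G i j : ℤ_[2]) : ℚ_[2]) = γ (b i) (b j) := fun i j => rfl
  have hdet : (G.map PadicInt.toZMod).det = 0 := by
    refine Matrix.det_eq_zero_of_symm_of_diag_zmod_two hodd _ (fun i j => ?_) fun i => ?_
    · simp only [Matrix.map_apply]
      congr 1
      exact Subtype.ext (hsymm _ _)
    · rw [Matrix.map_apply, ← PadicInt.two_dvd_iff_toZMod_eq_zero,
        ← IsIntegral2.half_coe_iff, hG]
      exact halt _ (b i).2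
  obtain ⟨v, hv0, hv⟩ := Matrix.exists_vecMul_eq_zero_iff.mpr hdet
  let c : Fin (Module.finrank ℚ_[2] V) → ℤ_[2] := fun i => ((v i).val : ℤ_[2])
  have hc : ∀ i, PadicInt.toZMod (c i) = v i := fun i => by simp [c]
  let w : L := ∑ i, c i • b i
  refine ⟨w, w.2, fun hw => hv0 (funext fun i => ?_), fun y hy => ?_⟩
  · have hw2 : w = (2 : ℤ_[2]) • (⟨_, hw⟩ : L) := by
      ext
      rw [Submodule.coe_smul, hsmul, PadicInt.coe_two, smul_inv_smul₀ two_ne_zero]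
    have hci : b.repr w i = c i := by
      simp only [w]
      rw [b.repr_sum_self]
    rw [Pi.zero_apply, ← hc, ← PadicInt.two_dvd_iff_toZMod_eq_zero, ← hci, hw2, map_smul,
      Finsupp.smul_apply, smul_eq_mul]
    exact dvd_mul_right _ _
  · have hbasis : ∀ j, IsIntegral2 (γ w (b j) / 2) := fun j => by
      have hval : γ w (b j) = ((Matrix.vecMul c G j : ℤ_[2]) : ℚ_[2]) := by
        simp only [w, Matrix.vecMul, dotProduct, Submodule.coe_sum, Submodule.coe_smul, hsmul,
          map_sum, map_smul, LinearMap.sum_apply, LinearMap.smul_apply, smul_eq_mul,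
          PadicInt.coe_sum, PadicInt.coe_mul, hG]
      rw [hval, IsIntegral2.half_coe_iff, PadicInt.two_dvd_iff_toZMod_eq_zero]
      have hj := congrFun hv j
      simpa [Matrix.vecMul, dotProduct, hc] using hj
    have hspan : (⟨y, hy⟩ : L) ∈ Submodule.span ℤ_[2] (Set.range b) := by
      rw [b.span_eq]; trivial
    suffices ∀ z ∈ Submodule.span ℤ_[2] (Set.range b), IsIntegral2 (γ w (z : V) / 2) from
      this _ hspan
    intro z hz
    induction hz using Submodule.span_induction with
    | mem z hz => obtain ⟨j, rfl⟩ := hz; exact hbasis j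
    | zero => simpa using IsIntegral2.coe 0
    | add x z _ _ hx hz => simpa [add_div] using hx.add hz
    | smul a z _ hz =>
      rw [Submodule.coe_smul, hsmul, map_smul, smul_eq_mul, mul_div_assoc]
      exact (IsIntegral2.coe a).mul hz

/-- In odd rank, a characteristic vector of a unimodular lattice has odd norm. -/
theorem not_isIntegral2_half_of_characteristic [FiniteDimensional ℚ_[2] V]
    (hodd : Odd (Module.finrank ℚ_[2] V)) (β : LinearMap.BilinForm ℚ_[2] V)
    {L : Submodule ℤ_[2] V} (hL : IsLattice L) (hsymm : ∀ x y, β x y = β y x)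
    (huni : ∀ x, (∀ y ∈ L, IsIntegral2 (β x y)) ↔ x ∈ L) {u : V} (hu : u ∈ L)
    (hchar : ∀ y ∈ L, IsIntegral2 ((β u y - β y y) / 2)) :
    ¬ IsIntegral2 (β u u / 2) := by
  intro huu
  have hint : ∀ x ∈ L, ∀ y ∈ L, IsIntegral2 (β x y) := fun x hx => (huni x).2 hx
  let γ : LinearMap.BilinForm ℚ_[2] V := β - LinearMap.BilinForm.linMulLin (β u) (β u)
  have hγ : ∀ x y, γ x y = β x y - β u x * β u y := fun x y => rfl
  obtain ⟨w, hw, hw2, hrad⟩ := exists_mem_radical_mod_two hodd γ hL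
    (fun x y => by rw [hγ, hγ, hsymm x y]; ring)
    (fun x hx y hy => (hint x hx y hy).sub ((hint u hu x hx).mul (hint u hu y hy)))
    (fun x hx => by
      have hux := hint u hu x hx
      have hpar : IsIntegral2 (β u x * (β u x - 1) / 2) := by
        rcases hux.half_or_half_sub_one with h | h
        · convert h.mul (hux.sub .one) using 1; ring
        · convert hux.mul h using 1; ring
      rw [hγ]
      convert (IsIntegral2.coe 0).sub (hpar.add (hchar x hx)) using 1
      push_cast
      ring)
  have huw := hint u hu w hw
  have hmem : (2⁻¹ : ℚ_[2]) • (w - β u w • u) ∈ L := (huni _).1 fun y hy => by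
    convert hrad y hy using 1
    simp only [hγ, map_smul, map_sub, LinearMap.smul_apply, LinearMap.sub_apply, smul_eq_mul]
    ring
  have heven : IsIntegral2 (β u w / 2) := by
    have h1 := hint u hu _ hmem
    convert h1.add (huw.mul huu) using 1
    simp only [map_smul, map_sub, smul_eq_mul]
    ring
  refine hw2 ((huni _).1 fun y hy => ?_)
  convert (hrad y hy).add (heven.mul (hint u hu y hy)) using 1
  simp only [hγ, map_smul, LinearMap.smul_apply, smul_eq_mul]
  ring

/-- In odd rank, a unimodular lattice `L` is recovered from its even-norm sublattice `Λ` as the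
set of those `x` in the dual of `Λ` for which `2x ∈ Λ`. -/
theorem mem_iff_inDual_and_two_smul_mem [FiniteDimensional ℚ_[2] V]
    (hodd : Odd (Module.finrank ℚ_[2] V)) (q : QuadraticForm ℚ_[2] V)
    {L : Submodule ℤ_[2] V} (hL : IsLattice L) (huni : IsUnimodular q L)
    {Λ : Submodule ℤ_[2] V} (hΛ : ∀ x, x ∈ Λ ↔ x ∈ L ∧ IsIntegral2 (q x / 2)) (x : V) :
    x ∈ L ↔ InDual q Λ x ∧ (2 : ℚ_[2]) • x ∈ Λ := by
  let β : LinearMap.BilinForm ℚ_[2] V := QuadraticMap.associated q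
  have hβ : ∀ x y, Bq q x y = β x y := Bq_eq_associated q
  have hβq : ∀ x, β x x = q x := QuadraticMap.associated_eq_self_apply ℚ_[2] q
  have hsymm : ∀ x y, β x y = β y x := QuadraticMap.associated_isSymm ℚ_[2] q
  have huni' : ∀ x, (∀ y ∈ L, IsIntegral2 (β x y)) ↔ x ∈ L := fun x => by
    simpa only [InDual, hβ] using huni x
  have hint : ∀ x ∈ L, ∀ y ∈ L, IsIntegral2 (β x y) := fun x hx => (huni' x).2 hx
  have hqL : ∀ x ∈ L, IsIntegral2 (q x) := fun x hx => hβq x ▸ hint x hx x hx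
  simp only [InDual, hβ]
  constructor
  · intro hx
    refine ⟨fun y hy => hint x hx y ((hΛ y).1 hy).1, (hΛ _).2 ⟨?_, ?_⟩⟩
    · rw [two_smul]; exact L.add_mem hx hx
    · rw [QuadraticMap.map_smul]
      convert IsIntegral2.two.mul (hqL x hx) using 1
      simp only [smul_eq_mul]
      ring
  · rintro ⟨hdual, h2x⟩
    by_contra hx
    obtain ⟨h2L, h2q⟩ := (hΛ _).1 h2x
    obtain ⟨y₀, hy₀, hxy₀⟩ : ∃ y ∈ L, ¬ IsIntegral2 (β x y) := by
      simpa using mt (huni' x).1 hx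
    have hy₀q : ¬ IsIntegral2 (q y₀ / 2) := fun h => hxy₀ (hdual _ ((hΛ _).2 ⟨hy₀, h⟩))
    refine not_isIntegral2_half_of_characteristic hodd β hL hsymm huni' h2L (fun y hy => ?_)
      (by rwa [hβq])
    have hxy : β ((2 : ℚ_[2]) • x) y / 2 = β x y := by simp
    rw [hβq]
    by_cases hyq : IsIntegral2 (q y / 2)
    · rw [sub_div, hxy]
      exact (hdual y ((hΛ y).2 ⟨hy, hyq⟩)).sub hyq
    · refine IsIntegral2.half_sub_of_not (hint _ h2L y hy) (hqL y hy) ?_ hyq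
      rw [hxy]
      intro h
      have hdiff : y - y₀ ∈ Λ := by
        refine (hΛ _).2 ⟨L.sub_mem hy hy₀, ?_⟩
        convert (IsIntegral2.half_sub_of_not (hqL y hy) (hqL y₀ hy₀) hyq hy₀q).add
          ((hqL y₀ hy₀).sub (hint y hy y₀ hy₀)) using 1
        simp only [← hβq, map_sub, LinearMap.sub_apply, hsymm y₀ y]
        ring
      refine hxy₀ ?_
      convert h.sub (hdual _ hdiff) using 1
      rw [map_sub, sub_sub_cancel]

end Lattice

/-- Let `(V, q)` over `ℚ₂` have odd dimension `d ≥ 3`, `L` an odd unimodular lattice and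
`Λ = {x ∈ L : q(x) ∈ 2ℤ₂}`. Then the stabilizers of `L` and of `Λ` in `SO(V,q)(ℚ₂)`
coincide: an isometry `g` of determinant 1 satisfies `g(L) = L` iff `g(Λ) = Λ`. -/
theorem stabilizers_coincide_odd_dim
    {V : Type*} [AddCommGroup V] [Module ℚ_[2] V] [Module ℤ_[2] V]
    [IsScalarTower ℤ_[2] ℚ_[2] V] [FiniteDimensional ℚ_[2] V]
    (d : ℕ) (hd3 : 3 ≤ d) (hdodd : Odd d) (hdim : Module.finrank ℚ_[2] V = d)
    (q : QuadraticForm ℚ_[2] V)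
    (hnd : ∀ x : V, (∀ y : V, Bq q x y = 0) → x = 0)
    (L : Submodule ℤ_[2] V) (hL : IsLattice L)
    (hLuni : IsUnimodular q L) (hLodd : ¬ IsEvenLat q L)
    (Λ : Submodule ℤ_[2] V)
    (hΛ : (Λ : Set V) = {x : V | x ∈ L ∧ IsIntegral2 (q x / 2)})
 :
    ∀ g : V ≃ₗ[ℚ_[2]] V, (∀ x : V, q (g x) = q x) → LinearEquiv.det g = 1 →
      (⇑g '' (L : Set V) = (L : Set V) ↔ ⇑g '' (Λ : Set V) = (Λ : Set V)) := by
  have hmemΛ : ∀ x, x ∈ Λ ↔ x ∈ L ∧ IsIntegral2 (q x / 2) := fun x => Set.ext_iff.1 hΛ x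
  have hrecover := mem_iff_inDual_and_two_smul_mem (hdim ▸ hdodd) q hL hLuni hmemΛ
  intro g hg _
  have himage : ∀ M : Submodule ℤ_[2] V,
      ⇑g '' (M : Set V) = (M : Set V) ↔ ∀ x, g x ∈ M ↔ x ∈ M := fun M => by
    rw [← (Set.image_injective.2 g.symm.injective).eq_iff, ← Set.image_comp, eq_comm]
    simp only [Set.ext_iff, LinearEquiv.image_symm_eq_preimage]
    simp
  have hBq : ∀ x y, Bq q (g x) (g y) = Bq q x y := fun x y => by
    simp only [Bq, ← map_add, hg]
  rw [himage, himage]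
  constructor
  · intro h x
    rw [hmemΛ, hmemΛ, h, hg]
  · intro h x
    rw [hrecover, hrecover, ← map_smul, h]
    refine and_congr_left' ⟨fun hx y hy => ?_, fun hx y hy => ?_⟩
    · rw [← hBq]
      exact hx _ ((h y).2 hy)
    · obtain ⟨z, rfl⟩ := g.surjective y
      rw [hBq]
      exact hx z ((h z).1 hy)
end
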